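/- arXiv:1801.10440 — 2 statements merged into one kernel-verified Lean document; each statement's English description precedes it below -/
import Mathlib

section
/- Let c, d : ℝ³ → ℂ³ be C¹ up to the boundary of Π, and suppose c has compact axial support. Then ∫_Π ⟨curl c, d⟩ dx = ∫_Π ⟨c, curl d⟩ dx + ∫_{∂Π} ⟨c, [d, ν]⟩ dS. -/
noncomputable section

open MeasureTheory Real Complex

/-- Points of `ℝ³`. -/
abbrev V3 := Fin 3 → ℝ
/-- Vectors of `ℂ³`. -/
abbrev C3 := Fin 3 → ℂ

/-- Partial derivative `∂ⱼ` of a complex scalar function on `ℝ³`. -/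
def pd (j : Fin 3) (f : V3 → ℂ) (x : V3) : ℂ := fderiv ℝ f x (Pi.single j 1)

/-- Partial derivative `∂ⱼ` of a real scalar function on `ℝ³`. -/
def pdR (j : Fin 3) (f : V3 → ℝ) (x : V3) : ℝ := fderiv ℝ f x (Pi.single j 1)

/-- Partial derivative `∂ⱼ` of a vector field, taken componentwise. -/
def pdV (j : Fin 3) (a : V3 → C3) (x : V3) : C3 := fun i => pd j (fun y => a y i) x

/-- curl a = (∂₂a₃ − ∂₃a₂, ∂₃a₁ − ∂₁a₃, ∂₁a₂ − ∂₂a₁)  (indices 0,1,2). -/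
def vcurl (a : V3 → C3) (x : V3) : C3 :=
  ![pd 1 (fun y => a y 2) x - pd 2 (fun y => a y 1) x,
    pd 2 (fun y => a y 0) x - pd 0 (fun y => a y 2) x,
    pd 0 (fun y => a y 1) x - pd 1 (fun y => a y 0) x]

/-- div a = ∂₁a₁ + ∂₂a₂ + ∂₃a₃. -/
def vdiv (a : V3 → C3) (x : V3) : ℂ := ∑ j, pd j (fun y => a y j) x

/-- The bilinear (unconjugated) cross product on ℂ³. -/
def cross (a b : C3) : C3 :=
  ![a 1 * b 2 - a 2 * b 1, a 2 * b 0 - a 0 * b 2, a 0 * b 1 - a 1 * b 0]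

/-- The Hermitian inner product ⟨a, b⟩ = Σⱼ aⱼ · conj(bⱼ). -/
def hinner (a b : C3) : ℂ := ∑ j, a j * (starRingEnd ℂ) (b j)

/-- The gradient of a real function, viewed as a complex vector. -/
def gradC (g : V3 → ℝ) (x : V3) : C3 := fun j => (pdR j g x : ℂ)

/-- The Laplacian Δg = ∂₁²g + ∂₂²g + ∂₃²g of a real function. -/
def lapR (g : V3 → ℝ) (x : V3) : ℝ := ∑ j, pdR j (fun y => pdR j g y) x

/-- The solid infinite circular cylinder Π of radius `R`. -/
def Cyl (R : ℝ) : Set V3 := {x | x 0 ^ 2 + x 1 ^ 2 < R ^ 2}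

/-- The boundary ∂Π of the cylinder. -/
def bCyl (R : ℝ) : Set V3 := {x | x 0 ^ 2 + x 1 ^ 2 = R ^ 2}

/-- The outward unit normal of the cylinder at a boundary point. -/
def nuR (R : ℝ) (x : V3) : V3 := ![x 0 / R, x 1 / R, 0]

/-- The outward unit normal, viewed as a complex vector. -/
def nuC (R : ℝ) (x : V3) : C3 := fun j => (nuR R x j : ℂ)

/-- The normal component ⟨z, ν⟩ of z ∈ ℂ³ at a boundary point of the cylinder. -/
def ncomp (R : ℝ) (x : V3) (z : C3) : ℂ := ∑ k, z k * (nuR R x k : ℂ)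

/-- The normal derivative ∂_ν g = ⟨∇g, ν⟩ of a real function at a boundary point. -/
def dnu (R : ℝ) (g : V3 → ℝ) (x : V3) : ℝ := ∑ k, pdR k g x * nuR R x k

/-- The surface integral ∫_{∂Π} F dS = ∫_ℝ ∫₀^{2π} F(R cos θ, R sin θ, t)·R dθ dt. -/
def surfInt (R : ℝ) (F : V3 → ℂ) : ℂ :=
  ∫ t : ℝ, ∫ θ in (0:ℝ)..(2 * π), F ![R * Real.cos θ, R * Real.sin θ, t] * (R : ℂ)

/-- `f` is `C^k` up to the boundary of the open set `S`: it is `k` times continuously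
differentiable on an open neighborhood of the closure of `S`. -/
def UpTo {E : Type*} [NormedAddCommGroup E] [NormedSpace ℝ E]
    (k : ℕ) (S : Set V3) (f : V3 → E) : Prop :=
  ∃ U : Set V3, IsOpen U ∧ closure S ⊆ U ∧ ContDiffOn ℝ k f U

/-- `f` has compact axial support: it vanishes whenever `|x₃| ≥ T` for some `T > 0`. -/
def AxialSupp {E : Type*} [Zero E] (f : V3 → E) : Prop :=
  ∃ T > 0, ∀ x : V3, T ≤ |x 2| → f x = 0

/-- The matrix W₀(μ)ⱼₖ = μ⁻¹(Δμ)δⱼₖ + μ⁻²(∂ⱼμ)(∂ₖμ) − μ⁻¹∂ⱼ∂ₖμ. -/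
def W0 (μ : V3 → ℝ) (x : V3) (j k : Fin 3) : ℝ :=
  (μ x)⁻¹ * lapR μ x * (if j = k then 1 else 0)
    + ((μ x) ^ 2)⁻¹ * pdR j μ x * pdR k μ x
    - (μ x)⁻¹ * pdR j (fun y => pdR k μ y) x

/-- The matrix W(μ)ⱼₖ = ((2μ)⁻¹Δμ − (4μ²)⁻¹|∇μ|²)δⱼₖ + μ⁻²(∂ⱼμ)(∂ₖμ) − μ⁻¹∂ⱼ∂ₖμ. -/
def Wm (μ : V3 → ℝ) (x : V3) (j k : Fin 3) : ℝ :=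
  ((2 * μ x)⁻¹ * lapR μ x - (4 * (μ x) ^ 2)⁻¹ * (∑ i, (pdR i μ x) ^ 2))
      * (if j = k then 1 else 0)
    + ((μ x) ^ 2)⁻¹ * pdR j μ x * pdR k μ x
    - (μ x)⁻¹ * pdR j (fun y => pdR k μ y) x


section DiscSlices

open Set intervalIntegral

/-- The integral over a disc of a derivative in the first variable, as a boundary integral. -/
lemma integral_disc_deriv_fst {R : ℝ} (hR : 0 < R) {h h' : ℝ → ℝ → ℂ}
    (hh : Continuous fun p : ℝ × ℝ => h p.1 p.2) (hh' : ∀ b, Continuous fun a => h' a b)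
    (hd : ∀ a b, HasDerivAt (fun a => h a b) (h' a b) a) :
    ∫ b, ∫ a, (if a ^ 2 + b ^ 2 < R ^ 2 then h' a b else 0)
      = ∫ θ in (0 : ℝ)..2 * π, h (R * Real.cos θ) (R * Real.sin θ) * ((R * Real.cos θ : ℝ) : ℂ) := by
  set G : ℝ → ℂ := fun b => h (√(R ^ 2 - b ^ 2)) b - h (-√(R ^ 2 - b ^ 2)) b with hG
  have hGc : Continuous G := by
    have hs : Continuous fun b : ℝ => √(R ^ 2 - b ^ 2) := by fun_prop
    exact (hh.comp (hs.prodMk continuous_id)).sub (hh.comp (hs.neg.prodMk continuous_id))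
  have inner_eq : ∀ b, ∫ a, (if a ^ 2 + b ^ 2 < R ^ 2 then h' a b else 0) = G b := by
    intro b
    have hle : -√(R ^ 2 - b ^ 2) ≤ √(R ^ 2 - b ^ 2) := by
      linarith [Real.sqrt_nonneg (R ^ 2 - b ^ 2)]
    have : (fun a => if a ^ 2 + b ^ 2 < R ^ 2 then h' a b else 0)
        = (Ioo (-√(R ^ 2 - b ^ 2)) (√(R ^ 2 - b ^ 2))).indicator (fun a => h' a b) := by
      funext a
      have : a ^ 2 + b ^ 2 < R ^ 2 ↔ a ∈ Ioo (-√(R ^ 2 - b ^ 2)) (√(R ^ 2 - b ^ 2)) := by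
        rw [mem_Ioo, ← Real.sq_lt, lt_sub_iff_add_lt]
      simp only [indicator, this]
    rw [this, MeasureTheory.integral_indicator measurableSet_Ioo, ← integral_Ioc_eq_integral_Ioo,
      ← intervalIntegral.integral_of_le hle]
    exact integral_eq_sub_of_hasDerivAt (fun a _ => hd a b) ((hh' b).intervalIntegrable _ _)
  have hsupp : Function.support G ⊆ Ioc (-R) R := by
    intro b hb
    by_contra hbR
    have hsq : R ^ 2 - b ^ 2 ≤ 0 := by
      rw [mem_Ioc, not_and_or, not_lt, not_le] at hbR
      rcases hbR with h1 | h1 <;> nlinarith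
    exact hb (by simp [hG, Real.sqrt_eq_zero_of_nonpos hsq])
  set k : ℝ → ℂ := fun θ =>
    h (R * Real.cos θ) (R * Real.sin θ) * ((R * Real.cos θ : ℝ) : ℂ) with hk
  have hkc : Continuous k := by
    have h1 : Continuous fun θ : ℝ => (R * Real.cos θ, R * Real.sin θ) := by fun_prop
    exact (hh.comp h1).mul (by fun_prop)
  have hper : Function.Periodic k (2 * π) := fun θ => by
    simp only [hk, Real.cos_add_two_pi, Real.sin_add_two_pi]
  calc ∫ b, ∫ a, (if a ^ 2 + b ^ 2 < R ^ 2 then h' a b else 0)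
      = ∫ b, G b := by simp only [inner_eq]
    _ = ∫ b in R * Real.sin (-(π / 2))..R * Real.sin (π / 2), G b := by
        rw [← integral_eq_integral_of_support_subset hsupp]
        simp
    _ = ∫ θ in -(π / 2)..π / 2, (R * Real.cos θ) • (G ∘ fun θ => R * Real.sin θ) θ :=
        (integral_deriv_smul_comp (fun θ _ => (Real.hasDerivAt_sin θ).const_mul R)
          (by fun_prop) hGc).symm
    _ = ∫ θ in -(π / 2)..π / 2, (k θ + k (π - θ)) := by
        refine integral_congr fun θ hθ => ?_
        rw [uIcc_of_le (by linarith [Real.pi_pos])] at hθ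
        have hcos : 0 ≤ R * Real.cos θ := mul_nonneg hR.le (Real.cos_nonneg_of_mem_Icc hθ)
        have hsq : R ^ 2 - (R * Real.sin θ) ^ 2 = (R * Real.cos θ) ^ 2 := by
          nlinarith [Real.sin_sq_add_cos_sq θ]
        simp only [Function.comp_apply, hG, hk, hsq, Real.sqrt_sq hcos, Real.cos_pi_sub,
          Real.sin_pi_sub, real_smul]
        push_cast
        rw [mul_neg R]
        ring
    _ = ∫ θ in -(π / 2)..(-(π / 2) + 2 * π), k θ := by
        rw [intervalIntegral.integral_add (hkc.intervalIntegrable _ _)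
          ((by fun_prop : Continuous fun θ => k (π - θ)).intervalIntegrable _ _),
          integral_comp_sub_left, sub_neg_eq_add, sub_half,
          integral_add_adjacent_intervals (hkc.intervalIntegrable _ _)
            (hkc.intervalIntegrable _ _)]
        congr 1
        ring
    _ = ∫ θ in (0 : ℝ)..2 * π, k θ := by
        simpa using hper.intervalIntegral_add_eq (-(π / 2)) 0

/-- The integral over a disc of a derivative in the second variable, as a boundary integral. -/
lemma integral_disc_deriv_snd {R : ℝ} (hR : 0 < R) {h h' : ℝ → ℝ → ℂ}
    (hh : Continuous fun p : ℝ × ℝ => h p.1 p.2) (hh' : ∀ a, Continuous fun b => h' a b)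
    (hd : ∀ a b, HasDerivAt (fun b => h a b) (h' a b) b) :
    ∫ a, ∫ b, (if a ^ 2 + b ^ 2 < R ^ 2 then h' a b else 0)
      = ∫ θ in (0 : ℝ)..2 * π, h (R * Real.cos θ) (R * Real.sin θ) * ((R * Real.sin θ : ℝ) : ℂ) := by
  have key := integral_disc_deriv_fst hR (h := fun a b => h b a) (h' := fun a b => h' b a)
    (hh.comp continuous_swap) hh' (fun a b => hd b a)
  have hcomm : ∀ a b : ℝ, (if a ^ 2 + b ^ 2 < R ^ 2 then h' a b else 0)
      = if b ^ 2 + a ^ 2 < R ^ 2 then h' a b else 0 := fun a b => by rw [add_comm]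
  refine (integral_congr_ae (.of_forall fun a =>
    integral_congr_ae (.of_forall fun b => hcomm a b))).trans (key.trans ?_)
  set k : ℝ → ℂ := fun θ =>
    h (R * Real.cos θ) (R * Real.sin θ) * ((R * Real.sin θ : ℝ) : ℂ) with hk
  have hper : Function.Periodic k (2 * π) := fun θ => by
    simp only [hk, Real.cos_add_two_pi, Real.sin_add_two_pi]
  have hrefl := integral_comp_sub_left (a := 0) (b := 2 * π) k (π / 2)
  simp only [hk, Real.cos_pi_div_two_sub, Real.sin_pi_div_two_sub] at hrefl
  have hshift := hper.intervalIntegral_add_eq (π / 2 - 2 * π) 0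
  rw [zero_add, sub_add_cancel] at hshift
  rw [← hshift, hrefl, sub_zero]

end DiscSlices

section Coordinates

lemma measurePreserving_axis_fst :
    MeasurePreserving (fun p : ℝ × ℝ × ℝ => (![p.2.1, p.2.2, p.1] : V3)) := by
  have h := (volume_preserving_piFinSuccAbove (fun _ : Fin 3 => ℝ) 2).symm.comp
    ((MeasurePreserving.id (volume : Measure ℝ)).prod (volume_preserving_finTwoArrow ℝ).symm)
  convert h using 1
  · funext p i
    fin_cases i <;> rfl
  · rfl

lemma measurePreserving_axis_fst_swap :
    MeasurePreserving (fun p : ℝ × ℝ × ℝ => (![p.2.2, p.2.1, p.1] : V3)) :=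
  measurePreserving_axis_fst.comp
    ((MeasurePreserving.id (volume : Measure ℝ)).prod Measure.measurePreserving_swap)

lemma measurePreserving_axis_last :
    MeasurePreserving (fun p : ℝ × ℝ × ℝ => (![p.1, p.2.1, p.2.2] : V3)) := by
  have h := (volume_preserving_piFinSuccAbove (fun _ : Fin 3 => ℝ) 0).symm.comp
    ((MeasurePreserving.id (volume : Measure ℝ)).prod (volume_preserving_finTwoArrow ℝ).symm)
  convert h using 1
  · funext p i
    fin_cases i <;> rfl
  · rfl

/-- Fubini in coordinates given by a measure preserving parametrization. -/
lemma MeasureTheory.MeasurePreserving.integral_iterated {X : Type*} [MeasureSpace X]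
    {Φ : ℝ × ℝ × ℝ → X}
    (hΦ : MeasurePreserving Φ) {F : X → ℂ} (hF : Integrable F) :
    ∫ x, F x = ∫ t, ∫ b, ∫ a, F (Φ (t, b, a)) ∧
      Integrable fun t => ∫ b, ∫ a, F (Φ (t, b, a)) := by
  have hcomp : Integrable (F ∘ Φ) := (hΦ.integrable_comp hF.aestronglyMeasurable).2 hF
  have hslice : ∀ᵐ t : ℝ, ∫ p : ℝ × ℝ, F (Φ (t, p)) = ∫ b, ∫ a, F (Φ (t, b, a)) := by
    filter_upwards [hcomp.prod_right_ae] with t ht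
    exact integral_prod _ ht
  refine ⟨?_, (Integrable.integral_prod_left hcomp).congr hslice⟩
  rw [← hΦ.map_eq, integral_map hΦ.measurable.aemeasurable
    (by rw [hΦ.map_eq]; exact hF.aestronglyMeasurable)]
  exact (integral_prod _ hcomp).trans (integral_congr_ae hslice)

end Coordinates

section CompactSupport

open Function

lemma hasDerivAt_update_pd {g : V3 → ℂ} (hg : Differentiable ℝ g) (j : Fin 3) (x : V3) (s : ℝ) :
    HasDerivAt (fun s => g (update x j s)) (pd j g (update x j s)) s :=
  (hg _).hasFDerivAt.comp_hasDerivAt s (hasDerivAt_update x j s)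

lemma ContDiff.continuous_pd {g : V3 → ℂ} (hg : ContDiff ℝ 1 g) (j : Fin 3) :
    Continuous (pd j g) :=
  (hg.continuous_fderiv one_ne_zero).clm_apply continuous_const

lemma HasCompactSupport.pd {g : V3 → ℂ} (hg : HasCompactSupport g) (j : Fin 3) :
    HasCompactSupport (pd j g) :=
  hg.fderiv_apply ℝ _

lemma ContDiff.integrable_pd {g : V3 → ℂ} (hg : ContDiff ℝ 1 g) (hs : HasCompactSupport g)
    (j : Fin 3) : Integrable (_root_.pd j g) :=
  (hg.continuous_pd j).integrable_of_hasCompactSupport (hs.pd j)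

lemma measurableSet_Cyl (R : ℝ) : MeasurableSet (Cyl R) :=
  (isOpen_lt (by fun_prop) continuous_const).measurableSet

/-- The surface integral over `∂Π` at height `t`. -/
def ringInt (R : ℝ) (F : V3 → ℂ) (t : ℝ) : ℂ :=
  ∫ θ in (0 : ℝ)..2 * π, F ![R * Real.cos θ, R * Real.sin θ, t] * (R : ℂ)

variable {R : ℝ} {g : V3 → ℂ}

lemma integral_Cyl_pd_zero (hR : 0 < R) (hg : ContDiff ℝ 1 g) (hs : HasCompactSupport g) :
    ∫ x in Cyl R, pd 0 g x = ∫ t, ringInt R (fun x => g x * nuC R x 0) t ∧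
      Integrable (ringInt R fun x => g x * nuC R x 0) := by
  have key := measurePreserving_axis_fst_swap.integral_iterated
    ((hg.integrable_pd hs 0).indicator (measurableSet_Cyl R))
  have hslice : ∀ t : ℝ, ∫ b, ∫ a, (Cyl R).indicator (pd 0 g) ![a, b, t]
      = ringInt R (fun x => g x * nuC R x 0) t := by
    intro t
    refine (integral_disc_deriv_fst hR (h := fun a b => g ![a, b, t])
      (h' := fun a b => pd 0 g ![a, b, t]) ?_ ?_ ?_).trans ?_
    · exact hg.continuous.comp (by fun_prop)
    · exact fun b => (hg.continuous_pd 0).comp (by fun_prop)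
    · intro a b
      have h := hasDerivAt_update_pd (hg.differentiable one_ne_zero) 0 ![0, b, t] a
      have hu : ∀ s, update ![0, b, t] 0 s = ![s, b, t] := fun s => by
        ext i; fin_cases i <;> simp
      simpa only [hu] using h
    · refine intervalIntegral.integral_congr fun θ _ => ?_
      have : (R : ℂ) ≠ 0 := by exact_mod_cast hR.ne'
      simp [nuC, nuR]
      field_simp
  simp only [hslice] at key
  rwa [integral_indicator (measurableSet_Cyl R)] at key

lemma integral_Cyl_pd_one (hR : 0 < R) (hg : ContDiff ℝ 1 g) (hs : HasCompactSupport g) :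
    ∫ x in Cyl R, pd 1 g x = ∫ t, ringInt R (fun x => g x * nuC R x 1) t ∧
      Integrable (ringInt R fun x => g x * nuC R x 1) := by
  have key := measurePreserving_axis_fst.integral_iterated
    ((hg.integrable_pd hs 1).indicator (measurableSet_Cyl R))
  have hslice : ∀ t : ℝ, ∫ a, ∫ b, (Cyl R).indicator (pd 1 g) ![a, b, t]
      = ringInt R (fun x => g x * nuC R x 1) t := by
    intro t
    refine (integral_disc_deriv_snd hR (h := fun a b => g ![a, b, t])
      (h' := fun a b => pd 1 g ![a, b, t]) ?_ ?_ ?_).trans ?_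
    · exact hg.continuous.comp (by fun_prop)
    · exact fun a => (hg.continuous_pd 1).comp (by fun_prop)
    · intro a b
      have h := hasDerivAt_update_pd (hg.differentiable one_ne_zero) 1 ![a, 0, t] b
      have hu : ∀ s, update ![a, 0, t] 1 s = ![a, s, t] := fun s => by
        ext i; fin_cases i <;> simp
      simpa only [hu] using h
    · refine intervalIntegral.integral_congr fun θ _ => ?_
      have : (R : ℂ) ≠ 0 := by exact_mod_cast hR.ne'
      simp [nuC, nuR]
      field_simp
  simp only [hslice] at key
  rwa [integral_indicator (measurableSet_Cyl R)] at key

lemma integral_Cyl_pd_two (hg : ContDiff ℝ 1 g) (hs : HasCompactSupport g) :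
    ∫ x in Cyl R, pd 2 g x = 0 := by
  rw [← integral_indicator (measurableSet_Cyl R), (measurePreserving_axis_last.integral_iterated
    ((hg.integrable_pd hs 2).indicator (measurableSet_Cyl R))).1]
  have hslice : ∀ a b : ℝ, ∫ t, (Cyl R).indicator (pd 2 g) ![a, b, t] = 0 := by
    intro a b
    by_cases hab : a ^ 2 + b ^ 2 < R ^ 2
    · have hmem : ∀ t, ![a, b, t] ∈ Cyl R := fun t => hab
      simp only [Set.indicator_of_mem (hmem _)]
      have hemb : Topology.IsClosedEmbedding fun t : ℝ => (![a, b, t] : V3) :=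
        LeftInverse.isClosedEmbedding (f := fun x : V3 => x 2) (fun _ => rfl)
          (by fun_prop) (by fun_prop)
      refine integral_eq_zero_of_hasDerivAt_of_integrable (f := fun t => g ![a, b, t])
        (fun t => ?_) ?_ ?_
      · have h := hasDerivAt_update_pd (hg.differentiable one_ne_zero) 2 ![a, b, 0] t
        have hu : ∀ s, update ![a, b, 0] 2 s = ![a, b, s] := fun s => by
          ext i; fin_cases i <;> simp
        simpa only [hu] using h
      · exact ((hg.continuous_pd 2).comp hemb.continuous).integrable_of_hasCompactSupport
          ((hs.pd 2).comp_isClosedEmbedding hemb)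
      · exact (hg.continuous.comp hemb.continuous).integrable_of_hasCompactSupport
          (hs.comp_isClosedEmbedding hemb)
    · have hmem : ∀ t, ![a, b, t] ∉ Cyl R := fun t => hab
      simp only [Set.indicator_of_notMem (hmem _), integral_zero]
  simp [hslice]

end CompactSupport

section Green

lemma pd_mul_conj {f g : V3 → ℂ} {x : V3} (hf : DifferentiableAt ℝ f x)
    (hg : DifferentiableAt ℝ g x) (j : Fin 3) :
    pd j (fun y => f y * (starRingEnd ℂ) (g y)) x
      = pd j f x * (starRingEnd ℂ) (g x) + f x * (starRingEnd ℂ) (pd j g x) := by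
  have hconj : HasFDerivAt (fun y => (starRingEnd ℂ) (g y))
      ((conjCLE : ℂ →L[ℝ] ℂ).comp (fderiv ℝ g x)) x :=
    (conjCLE : ℂ →L[ℝ] ℂ).hasFDerivAt.comp x hg.hasFDerivAt
  have hprod : HasFDerivAt (fun y => f y * (starRingEnd ℂ) (g y)) _ x := hf.hasFDerivAt.mul hconj
  simp only [pd, hprod.fderiv, add_apply, smul_apply, smul_eq_mul,
    ContinuousLinearMap.comp_apply, ContinuousLinearEquiv.coe_coe, conjCLE_apply]
  ring

lemma pd_sub {f g : V3 → ℂ} {x : V3} (hf : DifferentiableAt ℝ f x)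
    (hg : DifferentiableAt ℝ g x) (j : Fin 3) :
    pd j (fun y => f y - g y) x = pd j f x - pd j g x := by
  simp only [pd, fderiv_fun_sub hf hg]
  rfl

/-- Components of `[c, conj d]`. -/
def crossConj (c d : V3 → C3) (k : Fin 3) (x : V3) : ℂ :=
  cross (c x) (fun i => (starRingEnd ℂ) (d x i)) k

variable {c d : V3 → C3}

lemma contDiff_crossConj (hc : ContDiff ℝ 1 c) (hd : ContDiff ℝ 1 d) (k : Fin 3) :
    ContDiff ℝ 1 (crossConj c d k) := by
  have hc' := contDiff_pi.1 hc
  have hd' : ∀ i, ContDiff ℝ 1 fun x => (starRingEnd ℂ) (d x i) := fun i =>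
    (conjCLE : ℂ →L[ℝ] ℂ).contDiff.comp (contDiff_pi.1 hd i)
  have h : ∀ i j i' j', ContDiff ℝ 1 fun x =>
      c x i * (starRingEnd ℂ) (d x j) - c x i' * (starRingEnd ℂ) (d x j') := fun i j i' j' =>
    ((hc' i).mul (hd' j)).sub ((hc' i').mul (hd' j'))
  fin_cases k <;> exact h _ _ _ _

lemma hasCompactSupport_crossConj (hc : HasCompactSupport c) (k : Fin 3) :
    HasCompactSupport (crossConj c d k) := by
  refine hc.mono fun x hx hcx => hx ?_
  fin_cases k <;> simp [crossConj, cross, hcx]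

lemma sum_pd_crossConj (hc : ContDiff ℝ 1 c) (hd : ContDiff ℝ 1 d) (x : V3) :
    hinner (vcurl c x) (d x) - hinner (c x) (vcurl d x)
      = pd 0 (crossConj c d 0) x + pd 1 (crossConj c d 1) x + pd 2 (crossConj c d 2) x := by
  have hc' : ∀ i, DifferentiableAt ℝ (fun x => c x i) x := fun i =>
    (contDiff_pi.1 hc i).differentiable one_ne_zero x
  have hd' : ∀ i, DifferentiableAt ℝ (fun x => d x i) x := fun i =>
    (contDiff_pi.1 hd i).differentiable one_ne_zero x
  have hd'' : ∀ i, DifferentiableAt ℝ (fun x => (starRingEnd ℂ) (d x i)) x := fun i =>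
    (conjCLE : ℂ →L[ℝ] ℂ).differentiableAt.comp x (hd' i)
  have h : ∀ k i j i' j', pd k (fun x =>
      c x i * (starRingEnd ℂ) (d x j) - c x i' * (starRingEnd ℂ) (d x j')) x = _ :=
    fun k i j i' j' => (pd_sub ((hc' i).mul (hd'' j)) ((hc' i').mul (hd'' j')) k).trans
      (congrArg₂ _ (pd_mul_conj (hc' i) (hd' j) k) (pd_mul_conj (hc' i') (hd' j') k))
  have e0 := h 0 1 2 2 1
  have e1 := h 1 2 0 0 2
  have e2 := h 2 0 1 1 0
  rw [show crossConj c d 0 = _ from rfl, show crossConj c d 1 = _ from rfl,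
    show crossConj c d 2 = _ from rfl]
  refine Eq.trans ?_ (congrArg₂ _ (congrArg₂ _ e0 e1) e2).symm
  simp only [hinner, vcurl, Fin.sum_univ_three, Matrix.cons_val, map_sub]
  ring

lemma continuous_vcurl (hc : ContDiff ℝ 1 c) : Continuous (vcurl c) := by
  have h : ∀ j i, Continuous (pd j fun x => c x i) := fun j i =>
    (contDiff_pi.1 hc i).continuous_pd j
  refine continuous_pi fun k => ?_
  fin_cases k
  · exact (h 1 2).sub (h 2 1)
  · exact (h 2 0).sub (h 0 2)
  · exact (h 0 1).sub (h 1 0)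

lemma continuous_hinner {a b : V3 → C3} (ha : Continuous a) (hb : Continuous b) :
    Continuous fun x => hinner (a x) (b x) :=
  continuous_finsetSum _ fun j _ => ((continuous_apply j).comp ha).mul
    (continuous_conj.comp ((continuous_apply j).comp hb))

lemma ringInt_hinner_cross {R : ℝ} (hc : ContDiff ℝ 1 c) (hd : ContDiff ℝ 1 d) (t : ℝ) :
    ringInt R (fun x => hinner (c x) (cross (d x) (nuC R x))) t
      = ringInt R (fun x => crossConj c d 0 x * nuC R x 0) t
        + ringInt R (fun x => crossConj c d 1 x * nuC R x 1) t := by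
  have hint : ∀ k, IntervalIntegrable (fun θ : ℝ =>
      crossConj c d k ![R * Real.cos θ, R * Real.sin θ, t]
        * nuC R ![R * Real.cos θ, R * Real.sin θ, t] k * (R : ℂ)) volume 0 (2 * π) := by
    intro k
    refine Continuous.intervalIntegrable (((contDiff_crossConj hc hd k).continuous.comp
      (by fun_prop)).mul (Complex.continuous_ofReal.comp ?_) |>.mul continuous_const) _ _
    fin_cases k <;> simp [nuR] <;> fun_prop
  rw [ringInt, ringInt, ringInt, ← intervalIntegral.integral_add (hint 0) (hint 1)]
  congr 1
  funext θ
  simp only [hinner, cross, crossConj, nuC, nuR, Fin.sum_univ_three, Matrix.cons_val, map_sub,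
    map_mul, map_zero, conj_ofReal, ofReal_zero, mul_zero]
  ring

/-- Green's formula for the curl on the cylinder, for compactly supported fields. -/
lemma integral_hinner_vcurl_of_hasCompactSupport {R : ℝ} (hR : 0 < R) (hc : ContDiff ℝ 1 c)
    (hd : ContDiff ℝ 1 d) (hcs : HasCompactSupport c) (hds : HasCompactSupport d) :
    ∫ x in Cyl R, hinner (vcurl c x) (d x)
      = (∫ x in Cyl R, hinner (c x) (vcurl d x))
        + surfInt R (fun x => hinner (c x) (cross (d x) (nuC R x))) := by
  have h1 : Integrable fun x => hinner (vcurl c x) (d x) :=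
    (continuous_hinner (continuous_vcurl hc) hd.continuous).integrable_of_hasCompactSupport
      (hds.mono fun x hx hdx => hx (by simp [hinner, hdx]))
  have h2 : Integrable fun x => hinner (c x) (vcurl d x) :=
    (continuous_hinner hc.continuous (continuous_vcurl hd)).integrable_of_hasCompactSupport
      (hcs.mono fun x hx hcx => hx (by simp [hinner, hcx]))
  have hF := contDiff_crossConj hc hd
  have hFs := hasCompactSupport_crossConj (d := d) hcs
  have hFi : ∀ k, IntegrableOn (pd k (crossConj c d k)) (Cyl R) := fun k =>
    ((hF k).integrable_pd (hFs k) k).integrableOn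
  obtain ⟨e0, i0⟩ := integral_Cyl_pd_zero hR (hF 0) (hFs 0)
  obtain ⟨e1, i1⟩ := integral_Cyl_pd_one hR (hF 1) (hFs 1)
  rw [← sub_eq_iff_eq_add', ← integral_sub h1.integrableOn h2.integrableOn]
  simp only [sum_pd_crossConj hc hd]
  have hadd : IntegrableOn
      (fun x => pd 0 (crossConj c d 0) x + pd 1 (crossConj c d 1) x) (Cyl R) :=
    (hFi 0).add (hFi 1)
  rw [integral_add hadd (hFi 2), integral_add (hFi 0) (hFi 1), e0, e1,
    integral_Cyl_pd_two (hF 2) (hFs 2), add_zero, ← integral_add i0 i1]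
  exact integral_congr_ae (.of_forall fun t => (ringInt_hinner_cross hc hd t).symm)

end Green

section Localization

open Filter Topology

/-- A function of class `C¹` near a compact set agrees near it with a compactly supported one. -/
lemma exists_contDiff_hasCompactSupport_eventuallyEq {E F : Type*} [NormedAddCommGroup E]
    [NormedSpace ℝ E] [FiniteDimensional ℝ E] [NormedAddCommGroup F] [NormedSpace ℝ F]
    {n : ℕ} {K U : Set E} (hK : IsCompact K) (hU : IsOpen U) (hKU : K ⊆ U) {f : E → F}
    (hf : ContDiffOn ℝ n f U) :
    ∃ g : E → F, ContDiff ℝ n g ∧ HasCompactSupport g ∧ (∀ x ∈ K, g =ᶠ[𝓝 x] f) ∧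
      ∀ x, f x = 0 → g x = 0 := by
  obtain ⟨L, hL, hKL, hLU⟩ := exists_compact_between hK hU hKU
  obtain ⟨χ, hχ1, hχ0, -⟩ := exists_contMDiffMap_one_nhds_of_subset_interior
    (n := n) (modelWithCornersSelf ℝ E) hK.isClosed hKL
  have hχ : ContDiff ℝ n χ := χ.contMDiff.contDiff
  refine ⟨fun x => χ x • f x, contDiff_iff_contDiffAt.2 fun x => ?_,
    .intro hL fun x hx => by simp [hχ0 x hx], fun x hx => ?_, fun x hx => by simp [hx]⟩
  · by_cases hx : x ∈ L
    · exact hχ.contDiffAt.smul (hf.contDiffAt (hU.mem_nhds (hLU hx)))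
    · refine (contDiffAt_const (c := (0 : F))).congr_of_eventuallyEq ?_
      filter_upwards [hL.isClosed.isOpen_compl.mem_nhds hx] with y hy
      simp [hχ0 y hy]
  · filter_upwards [eventually_nhdsSet_iff_forall.1 hχ1 x hx] with y hy
    simp [hy]

lemma Filter.EventuallyEq.vcurl_eq {a b : V3 → C3} {x : V3} (h : a =ᶠ[𝓝 x] b) :
    vcurl a x = vcurl b x := by
  have hpd : ∀ j i, pd j (fun y => a y i) x = pd j (fun y => b y i) x := fun j i => by
    have : (fun y => a y i) =ᶠ[𝓝 x] fun y => b y i := h.mono fun y hy => congrFun hy i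
    rw [pd, pd, this.fderiv_eq]
  simp only [vcurl, hpd]

lemma vcurl_eq_zero {a : V3 → C3} {x : V3} (h : a =ᶠ[𝓝 x] 0) : vcurl a x = 0 := by
  rw [h.vcurl_eq]
  ext i
  fin_cases i <;> simp [vcurl, pd]

/-- The part of the closed cylinder with `|x₃| ≤ T`. -/
lemma isCompact_truncated_cyl (R T : ℝ) :
    IsCompact {x : V3 | x 0 ^ 2 + x 1 ^ 2 ≤ R ^ 2 ∧ |x 2| ≤ T} := by
  refine Metric.isCompact_of_isClosed_isBounded ?_ ?_
  · have h1 : Continuous fun x : V3 => x 0 ^ 2 + x 1 ^ 2 := by fun_prop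
    have h2 : Continuous fun x : V3 => |x 2| := by fun_prop
    exact (isClosed_le h1 continuous_const).inter (isClosed_le h2 continuous_const)
  · refine (Metric.isBounded_closedBall (x := (0 : V3)) (r := |R| + |T|)).subset ?_
    rintro x ⟨hx, hT⟩
    rw [mem_closedBall_zero_iff, pi_norm_le_iff_of_nonneg (by positivity)]
    have h0 : |x 0| ≤ |R| := sq_le_sq.1 (by nlinarith [sq_nonneg (x 1)])
    have h1 : |x 1| ≤ |R| := sq_le_sq.1 (by nlinarith [sq_nonneg (x 0)])
    intro i
    fin_cases i <;> simp only [Real.norm_eq_abs] <;>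
      linarith! [abs_nonneg R, abs_nonneg T, le_abs_self T]

lemma closedCyl_subset_closure {R : ℝ} (hR : 0 < R) :
    {x : V3 | x 0 ^ 2 + x 1 ^ 2 ≤ R ^ 2} ⊆ closure (Cyl R) := by
  intro x hx
  have htend : Tendsto (fun s : ℝ => s • x) (𝓝[<] 1) (𝓝 x) := by
    have : Tendsto (fun s : ℝ => s • x) (𝓝 1) (𝓝 ((1 : ℝ) • x)) :=
      (by fun_prop : Continuous fun s : ℝ => s • x).tendsto 1
    simpa using this.mono_left nhdsWithin_le_nhds
  refine mem_closure_of_tendsto htend ?_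
  filter_upwards [Ioo_mem_nhdsLT (zero_lt_one' ℝ)] with s hs
  have hs2 : s ^ 2 < 1 := by nlinarith [hs.1, hs.2]
  have hx' : x 0 ^ 2 + x 1 ^ 2 ≤ R ^ 2 := hx
  simp only [Cyl, Set.mem_ofPred_eq, Pi.smul_apply, smul_eq_mul]
  nlinarith [sq_nonneg s, pow_pos hR 2, mul_le_mul_of_nonneg_left hx' (sq_nonneg s)]

end Localization

/-- ∫_Π ⟨curl c, d⟩ = ∫_Π ⟨c, curl d⟩ + ∫_{∂Π} ⟨c, [d, ν]⟩. -/
theorem statement5 (R : ℝ) (hR : 0 < R) (c d : V3 → C3)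
    (hc : UpTo 1 (Cyl R) c) (hd : UpTo 1 (Cyl R) d) (hcs : AxialSupp c) :
    ∫ x in Cyl R, hinner (vcurl c x) (d x)
      = (∫ x in Cyl R, hinner (c x) (vcurl d x))
        + surfInt R (fun x => hinner (c x) (cross (d x) (nuC R x))) := by
  obtain ⟨U, hU, hcU, hc⟩ := hc
  obtain ⟨V, hV, hcV, hd⟩ := hd
  obtain ⟨T, -, hT⟩ := hcs
  set K := {x : V3 | x 0 ^ 2 + x 1 ^ 2 ≤ R ^ 2 ∧ |x 2| ≤ T} with hK
  have hKc : K ⊆ closure (Cyl R) := fun x hx => closedCyl_subset_closure hR hx.1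
  have hKcpt := isCompact_truncated_cyl R T
  obtain ⟨c', hc', hcs', hcc', hc0⟩ := exists_contDiff_hasCompactSupport_eventuallyEq
    hKcpt hU (hKc.trans hcU) hc
  obtain ⟨d', hd', hds', hdd', -⟩ := exists_contDiff_hasCompactSupport_eventuallyEq
    hKcpt hV (hKc.trans hcV) hd
  have hfar : ∀ x : V3, T < |x 2| → c =ᶠ[nhds x] 0 ∧ c' =ᶠ[nhds x] 0 := fun x hx => by
    have hev : c =ᶠ[nhds x] 0 := by
      filter_upwards [(isOpen_lt continuous_const
        (by fun_prop : Continuous fun y : V3 => |y 2|)).mem_nhds hx] with y hy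
      exact hT y (le_of_lt hy)
    exact ⟨hev, hev.mono fun y hy => hc0 y hy⟩
  have key := integral_hinner_vcurl_of_hasCompactSupport hR (by exact_mod_cast hc')
    (by exact_mod_cast hd') hcs' hds'
  convert key using 1
  · refine setIntegral_congr_fun (measurableSet_Cyl R) fun x hx => ?_
    by_cases hxT : |x 2| ≤ T
    · have hxK : x ∈ K := ⟨le_of_lt hx, hxT⟩
      simp only [(hcc' x hxK).vcurl_eq, (hdd' x hxK).eq_of_nhds]
    · obtain ⟨h, h'⟩ := hfar x (not_le.1 hxT)
      simp only [vcurl_eq_zero h, vcurl_eq_zero h', hinner, Pi.zero_apply, zero_mul]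
  · congr 1
    · refine setIntegral_congr_fun (measurableSet_Cyl R) fun x hx => ?_
      by_cases hxT : |x 2| ≤ T
      · have hxK : x ∈ K := ⟨le_of_lt hx, hxT⟩
        simp only [(hdd' x hxK).vcurl_eq, (hcc' x hxK).eq_of_nhds]
      · obtain ⟨h, h'⟩ := hfar x (not_le.1 hxT)
        simp only [h.eq_of_nhds, h'.eq_of_nhds, hinner, Pi.zero_apply, zero_mul]
    · refine integral_congr_ae (.of_forall fun t => ?_)
      refine intervalIntegral.integral_congr fun θ _ => ?_
      set x : V3 := ![R * Real.cos θ, R * Real.sin θ, t] with hx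
      have hx2 : x 0 ^ 2 + x 1 ^ 2 ≤ R ^ 2 := by
        simp only [hx, Matrix.cons_val]
        nlinarith [Real.sin_sq_add_cos_sq θ]
      by_cases hxT : |x 2| ≤ T
      · have hxK : x ∈ K := ⟨hx2, hxT⟩
        simp only [(hcc' x hxK).eq_of_nhds, (hdd' x hxK).eq_of_nhds]
      · obtain ⟨h, h'⟩ := hfar x (not_le.1 hxT)
        simp only [h.eq_of_nhds, h'.eq_of_nhds, hinner, Pi.zero_apply, zero_mul]

end
end

section
/- Let μ : ℝ³ → ℝ be C² up to the boundary of Π with μ > 0 on the closure of Π, and let a, b : ℝ³ → ℂ³ be C¹ up to the boundary with a of compact axial support. Then ∫_Π Σⱼ ⟨∂ⱼ(μa), ∂ⱼ(μ⁻¹b)⟩ dx = ∫_Π Σⱼ ⟨∂ⱼ(μ^{1/2}a), ∂ⱼ(μ^{−1/2}b)⟩ dx − ∫_Π μ⁻¹ Σⱼ (∂ⱼμ)·⟨∂ⱼa, b⟩ dx − ∫_Π ((4μ²)⁻¹|∇μ|² + (2μ)⁻¹Δμ)·⟨a, b⟩ dx + ∫_{∂Π} (2μ)⁻¹·(∂_νμ)·⟨a,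 b⟩ dS, where ∂_νμ = ⟨∇μ, ν⟩ and Δμ = ∂₁²μ + ∂₂²μ + ∂₃²μ. -/
noncomputable section

open MeasureTheory Real Complex

/-- A continuous linear map on the plane is determined by its values on the standard basis. -/
theorem clm_prod_apply {E : Type*} [NormedAddCommGroup E] [NormedSpace ℝ E]
    (L : ℝ × ℝ →L[ℝ] E) (x y : ℝ) : L (x, y) = x • L (1, 0) + y • L (0, 1) := by
  rw [← map_smul, ← map_smul, ← map_add]
  simp

/-- Integration over a disc in polar coordinates. -/
theorem integral_disc_eq_polar {E : Type*} [NormedAddCommGroup E] [NormedSpace ℝ E]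
    {R : ℝ} (hR : 0 < R) (h : ℝ × ℝ → E) :
    ∫ p in {p : ℝ × ℝ | p.1 ^ 2 + p.2 ^ 2 < R ^ 2}, h p
      = ∫ q in Set.Icc ((0 : ℝ), -π) (R, π),
          q.1 • h (q.1 * Real.cos q.2, q.1 * Real.sin q.2) := by
  have hD : MeasurableSet {p : ℝ × ℝ | p.1 ^ 2 + p.2 ^ 2 < R ^ 2} :=
    measurableSet_lt (by fun_prop) (by fun_prop)
  rw [← integral_indicator hD, ← integral_comp_polarCoord_symm, ← Set.Icc_prod_Icc]
  have hae : (Set.Icc (0 : ℝ) R ×ˢ Set.Icc (-π) π : Set (ℝ × ℝ)) =ᵐ[volume]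
      (Set.Ioo (0 : ℝ) R ×ˢ Set.Ioo (-π) π : Set (ℝ × ℝ)) :=
    Measure.set_prod_ae_eq Ioo_ae_eq_Icc.symm Ioo_ae_eq_Icc.symm
  rw [setIntegral_congr_set hae]
  have hsub : (Set.Ioo (0 : ℝ) R ×ˢ Set.Ioo (-π) π : Set (ℝ × ℝ)) ⊆ polarCoord.target := by
    rintro q ⟨h1, h2⟩
    exact ⟨h1.1, h2⟩
  have hsq : ∀ q : ℝ × ℝ, (q.1 * Real.cos q.2) ^ 2 + (q.1 * Real.sin q.2) ^ 2 = q.1 ^ 2 := by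
    intro q
    nlinarith [Real.sin_sq_add_cos_sq q.2]
  rw [setIntegral_eq_of_subset_of_forall_sdiff_eq_zero polarCoord.open_target.measurableSet hsub]
  · refine setIntegral_congr_fun (measurableSet_Ioo.prod measurableSet_Ioo) ?_
    rintro q ⟨h1, h2⟩
    have : q.1 ^ 2 < R ^ 2 := pow_lt_pow_left₀ h1.2 h1.1.le two_ne_zero
    simp [Set.indicator, hsq, this]
  · rintro q ⟨h1, h2⟩
    have h3 : ¬ q.1 ^ 2 < R ^ 2 := fun h4 =>
      h2 ⟨⟨h1.1, lt_of_pow_lt_pow_left₀ 2 hR.le h4⟩, h1.2⟩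
    simp [Set.indicator, hsq, h3]

/-- Integrals of `2π`-periodic trigonometric expressions over `[-π, π]` and `[0, 2π]` agree. -/
theorem integral_circle_shift {E : Type*} [NormedAddCommGroup E] [NormedSpace ℝ E]
    (G : ℝ → ℝ → E) :
    ∫ θ in (-π)..π, G (Real.cos θ) (Real.sin θ)
      = ∫ θ in (0 : ℝ)..(2 * π), G (Real.cos θ) (Real.sin θ) := by
  have hp : Function.Periodic (fun θ => G (Real.cos θ) (Real.sin θ)) (2 * π) := fun θ => by
    simp
  have := hp.intervalIntegral_add_eq (-π) 0
  rwa [show -π + 2 * π = π by ring, zero_add] at this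

/-- **Divergence theorem on a disc.** -/
theorem integral_divergence_disc {E : Type*} [NormedAddCommGroup E] [NormedSpace ℝ E]
    [CompleteSpace E] {R : ℝ} (hR : 0 < R)
    {f g : ℝ × ℝ → E} {V : Set (ℝ × ℝ)} (hV : IsOpen V)
    (hDV : {p : ℝ × ℝ | p.1 ^ 2 + p.2 ^ 2 ≤ R ^ 2} ⊆ V)
    (hf : ContDiffOn ℝ 1 f V) (hg : ContDiffOn ℝ 1 g V) :
    ∫ p in {p : ℝ × ℝ | p.1 ^ 2 + p.2 ^ 2 < R ^ 2},
        (fderiv ℝ f p (1, 0) + fderiv ℝ g p (0, 1))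
      = ∫ θ in (0 : ℝ)..(2 * π), R • (Real.cos θ • f (R * Real.cos θ, R * Real.sin θ)
          + Real.sin θ • g (R * Real.cos θ, R * Real.sin θ)) := by
  rw [integral_disc_eq_polar hR]
  let pol : ℝ × ℝ → ℝ × ℝ := fun q => (q.1 * Real.cos q.2, q.1 * Real.sin q.2)
  have hpolc : Continuous pol := by fun_prop
  have hmem : ∀ q ∈ Set.Icc ((0 : ℝ), -π) (R, π), pol q ∈ V := by
    intro q hq
    refine hDV ?_
    have h1 : q.1 ^ 2 ≤ R ^ 2 := pow_le_pow_left₀ hq.1.1 hq.2.1 2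
    have h2 : (q.1 * Real.cos q.2) ^ 2 + (q.1 * Real.sin q.2) ^ 2 = q.1 ^ 2 := by
      nlinarith [Real.sin_sq_add_cos_sq q.2]
    exact h2.trans_le h1
  have hmaps : Set.MapsTo pol (Set.Icc ((0 : ℝ), -π) (R, π)) V := hmem
  let P : ℝ × ℝ → E := fun q => q.1 • (Real.cos q.2 • f (pol q) + Real.sin q.2 • g (pol q))
  let Q : ℝ × ℝ → E := fun q => Real.cos q.2 • g (pol q) - Real.sin q.2 • f (pol q)
  have hfd : ContinuousOn (fun q => fderiv ℝ f (pol q)) (Set.Icc ((0 : ℝ), -π) (R, π)) :=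
    (hf.continuousOn_fderiv_of_isOpen hV le_rfl).comp hpolc.continuousOn hmaps
  have hgd : ContinuousOn (fun q => fderiv ℝ g (pol q)) (Set.Icc ((0 : ℝ), -π) (R, π)) :=
    (hg.continuousOn_fderiv_of_isOpen hV le_rfl).comp hpolc.continuousOn hmaps
  have hdiff : ∀ {u : ℝ × ℝ → E}, ContDiffOn ℝ 1 u V → ∀ q ∈ Set.Icc ((0 : ℝ), -π) (R, π),
      HasFDerivAt (fun q => u (pol q))
        ((fderiv ℝ u (pol q)).comp (fderivPolarCoordSymm q)) q := by
    intro u hu q hq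
    have h1 : HasFDerivAt u (fderiv ℝ u (pol q)) (pol q) :=
      ((hu.contDiffAt (hV.mem_nhds (hmem q hq))).differentiableAt one_ne_zero).hasFDerivAt
    exact h1.comp q (hasFDerivAt_polarCoord_symm q)
  have hcos : ∀ q : ℝ × ℝ, HasFDerivAt (fun q : ℝ × ℝ => Real.cos q.2)
      ((-Real.sin q.2) • ContinuousLinearMap.snd ℝ ℝ ℝ) q := fun q =>
    (Real.hasDerivAt_cos q.2).comp_hasFDerivAt q hasFDerivAt_snd
  have hsin : ∀ q : ℝ × ℝ, HasFDerivAt (fun q : ℝ × ℝ => Real.sin q.2)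
      ((Real.cos q.2) • ContinuousLinearMap.snd ℝ ℝ ℝ) q := fun q =>
    (Real.hasDerivAt_sin q.2).comp_hasFDerivAt q hasFDerivAt_snd
  have hP := fun q hq => (hasFDerivAt_fst (𝕜 := ℝ) (E := ℝ) (F := ℝ) (p := q)).smul
    (((hcos q).smul (hdiff hf q hq)).add ((hsin q).smul (hdiff hg q hq)))
  have hQ := fun q hq => ((hcos q).smul (hdiff hg q hq)).sub ((hsin q).smul (hdiff hf q hq))
  have hpolar : ∀ q : ℝ × ℝ, fderivPolarCoordSymm q (1, 0) = (Real.cos q.2, Real.sin q.2) ∧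
      fderivPolarCoordSymm q (0, 1) = (-q.1 * Real.sin q.2, q.1 * Real.cos q.2) := by
    intro q
    simp [fderivPolarCoordSymm, Matrix.toLin_finTwoProd_apply]
  have key : ∀ q ∈ Set.Icc ((0 : ℝ), -π) (R, π),
      fderiv ℝ P q (1, 0) + fderiv ℝ Q q (0, 1)
        = q.1 • (fderiv ℝ f (pol q) (1, 0) + fderiv ℝ g (pol q) (0, 1)) := by
    intro q hq
    have e1 : fderiv ℝ P q = _ := (hP q hq).fderiv
    have e2 : fderiv ℝ Q q = _ := (hQ q hq).fderiv
    rw [e1, e2]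
    simp only [add_apply, sub_apply, smul_apply, ContinuousLinearMap.smulRight_apply,
      ContinuousLinearMap.comp_apply, (hpolar q).1, (hpolar q).2, Pi.add_apply, Pi.smul_apply',
      ContinuousLinearMap.coe_fst', ContinuousLinearMap.coe_snd',
      clm_prod_apply _ (Real.cos q.2) _, clm_prod_apply _ (-q.1 * Real.sin q.2) _]
    rw [show q.1 • (fderiv ℝ f (pol q) (1, 0) + fderiv ℝ g (pol q) (0, 1))
        = (q.1 * (Real.sin q.2 ^ 2 + Real.cos q.2 ^ 2)) •
          (fderiv ℝ f (pol q) (1, 0) + fderiv ℝ g (pol q) (0, 1)) by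
      rw [Real.sin_sq_add_cos_sq, mul_one]]
    simp only [smul_eq_mul]
    module
  have hint : IntegrableOn (fun q => fderiv ℝ P q (1, 0) + fderiv ℝ Q q (0, 1))
      (Set.Icc ((0 : ℝ), -π) (R, π)) := by
    refine IntegrableOn.congr_fun ?_ (fun q hq => (key q hq).symm) measurableSet_Icc
    refine ContinuousOn.integrableOn_compact isCompact_Icc ?_
    exact continuousOn_fst.smul ((hfd.clm_apply continuousOn_const).add
      (hgd.clm_apply continuousOn_const))
  have hsub : ∀ q ∈ Set.Ioo ((0 : ℝ), -π).1 (R, π).1 ×ˢ Set.Ioo ((0 : ℝ), -π).2 (R, π).2,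
      q ∈ Set.Icc ((0 : ℝ), -π) (R, π) := fun q hq =>
    ⟨⟨hq.1.1.le, hq.2.1.le⟩, ⟨hq.1.2.le, hq.2.2.le⟩⟩
  have main := integral_divergence_prod_Icc_of_hasFDerivAt_of_le P Q (fderiv ℝ P) (fderiv ℝ Q)
    (0, -π) (R, π) ⟨hR.le, by simpa using (by linarith [Real.pi_pos] : -π ≤ π)⟩
    (fun q hq => (hP q hq).continuousAt.continuousWithinAt)
    (fun q hq => (hQ q hq).continuousAt.continuousWithinAt)
    (fun q hq => (hP q (hsub q hq)).differentiableAt.hasFDerivAt)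
    (fun q hq => (hQ q (hsub q hq)).differentiableAt.hasFDerivAt) hint
  rw [setIntegral_congr_fun measurableSet_Icc key] at main
  refine main.trans ?_
  rw [← integral_circle_shift (fun c s => R • (c • f (R * c, R * s) + s • g (R * c, R * s)))]
  simp [P, Q, pol]

theorem isOpen_cyl (R : ℝ) : IsOpen (Cyl R) :=
  isOpen_lt (by fun_prop) (by fun_prop)

theorem mem_closure_cyl {R : ℝ} (hR : 0 < R) {x : V3} (hx : x 0 ^ 2 + x 1 ^ 2 ≤ R ^ 2) :
    x ∈ closure (Cyl R) := by
  have h1 : (1 : ℝ) ∈ closure (Set.Ico (0 : ℝ) 1) := by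
    rw [closure_Ico zero_ne_one]
    exact ⟨zero_le_one, le_rfl⟩
  have hc : Continuous fun s : ℝ => (![s * x 0, s * x 1, x 2] : V3) := by
    refine continuous_pi fun i => ?_
    fin_cases i <;> simp <;> fun_prop
  have hm : Set.MapsTo (fun s : ℝ => (![s * x 0, s * x 1, x 2] : V3)) (Set.Ico (0 : ℝ) 1)
      (Cyl R) := by
    intro s hs
    have h2 : s ^ 2 < 1 := pow_lt_one₀ hs.1 hs.2 two_ne_zero
    have h3 : s ^ 2 * (x 0 ^ 2 + x 1 ^ 2) ≤ s ^ 2 * R ^ 2 :=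
      mul_le_mul_of_nonneg_left hx (sq_nonneg s)
    have h4 : s ^ 2 * R ^ 2 < 1 * R ^ 2 := mul_lt_mul_of_pos_right h2 (by positivity)
    simp only [Cyl, Set.mem_ofPred_eq, Matrix.cons_val_zero, Matrix.cons_val_one]
    nlinarith
  have := map_mem_closure hc h1 hm
  convert this using 1
  ext i
  fin_cases i <;> simp

/-- A function continuous near the closed cylinder and vanishing far along the axis is
integrable over the cylinder. -/
theorem integrableOn_cyl {E : Type*} [NormedAddCommGroup E]
    {R : ℝ} (hR : 0 < R) {U : Set V3} (hU : closure (Cyl R) ⊆ U) {f : V3 → E}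
    (hf : ContinuousOn f U) {T : ℝ} (hT : ∀ x, T < |x 2| → f x = 0) :
    IntegrableOn f (Cyl R) := by
  let K : Set V3 := {x | x 0 ^ 2 + x 1 ^ 2 ≤ R ^ 2} ∩ {x | |x 2| ≤ T}
  have hKc : IsClosed K :=
    (isClosed_le (by fun_prop) (by fun_prop)).inter (isClosed_le (by fun_prop) (by fun_prop))
  have hK : IsCompact K := by
    refine IsCompact.of_isClosed_subset (isCompact_Icc (a := (![-R, -R, -T] : V3))
      (b := ![R, R, T])) hKc ?_
    rintro x ⟨h1, h2⟩
    rw [Set.mem_ofPred_eq] at h1 h2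
    have h3 := abs_le_of_sq_le_sq' (show x 0 ^ 2 ≤ R ^ 2 by nlinarith [sq_nonneg (x 1)]) hR.le
    have h4 := abs_le_of_sq_le_sq' (show x 1 ^ 2 ≤ R ^ 2 by nlinarith [sq_nonneg (x 0)]) hR.le
    have h5 := abs_le.1 h2
    constructor <;> intro i <;> fin_cases i <;> simp [h3, h4, h5]
  have hKU : K ⊆ U := fun x hx => hU (mem_closure_cyl hR hx.1)
  refine IntegrableOn.of_forall_sdiff_eq_zero ((hf.mono hKU).integrableOn_compact hK)
    (isOpen_cyl R).measurableSet ?_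
  rintro x ⟨h1, h2⟩
  exact hT x (lt_of_not_ge fun h3 => h2 ⟨le_of_lt (Set.mem_ofPred_eq ▸ h1), h3⟩)

/-- The identification of the plane times the axis with `ℝ³`. -/
def planeAxis : (ℝ × ℝ) × ℝ ≃ᵐ V3 :=
  (MeasurableEquiv.prodComm.trans
    ((MeasurableEquiv.refl ℝ).prodCongr (MeasurableEquiv.finTwoArrow (α := ℝ)).symm)).trans
    (MeasurableEquiv.piFinSuccAbove (fun _ => ℝ) (2 : Fin 3)).symm

theorem planeAxis_apply (p : ℝ × ℝ) (t : ℝ) : planeAxis (p, t) = ![p.1, p.2, t] := by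
  ext i
  fin_cases i <;> rfl

theorem measurePreserving_planeAxis : MeasurePreserving planeAxis := by
  refine ((volume_preserving_piFinSuccAbove (fun _ => ℝ) (2 : Fin 3)).symm).comp ?_
  exact ((MeasurePreserving.id volume).prod ((volume_preserving_finTwoArrow ℝ).symm)).comp
    Measure.measurePreserving_swap

theorem planeAxis_preimage_cyl (R : ℝ) :
    planeAxis ⁻¹' Cyl R = {p : ℝ × ℝ | p.1 ^ 2 + p.2 ^ 2 < R ^ 2} ×ˢ Set.univ := by
  ext ⟨p, t⟩
  simp [planeAxis_apply, Cyl]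

theorem integrableOn_planeAxis {E : Type*} [NormedAddCommGroup E]
    {R : ℝ} {f : V3 → E} (hf : IntegrableOn f (Cyl R)) :
    Integrable (fun q : (ℝ × ℝ) × ℝ => f ![q.1.1, q.1.2, q.2])
      ((volume.restrict {p : ℝ × ℝ | p.1 ^ 2 + p.2 ^ 2 < R ^ 2}).prod volume) := by
  have := (measurePreserving_planeAxis.integrableOn_comp_preimage
    planeAxis.measurableEmbedding (f := f) (s := Cyl R)).2 hf
  rw [planeAxis_preimage_cyl, IntegrableOn, Measure.volume_eq_prod,
    ← Measure.prod_restrict, Measure.restrict_univ] at this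
  refine this.congr (Filter.Eventually.of_forall fun q => ?_)
  simp [← planeAxis_apply]

theorem setIntegral_cyl {E : Type*} [NormedAddCommGroup E] [NormedSpace ℝ E]
    (R : ℝ) (f : V3 → E) :
    ∫ x in Cyl R, f x = ∫ q : (ℝ × ℝ) × ℝ, f ![q.1.1, q.1.2, q.2]
      ∂((volume.restrict {p : ℝ × ℝ | p.1 ^ 2 + p.2 ^ 2 < R ^ 2}).prod volume) := by
  rw [← measurePreserving_planeAxis.setIntegral_preimage_emb planeAxis.measurableEmbedding,
    planeAxis_preimage_cyl, Measure.volume_eq_prod, ← Measure.prod_restrict,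
    Measure.restrict_univ]
  simp [← planeAxis_apply]

/-- Derivative of a function on `ℝ³` along a horizontal slice. -/
theorem fderiv_slice {f : V3 → ℂ} {p : ℝ × ℝ} {t : ℝ}
    (hf : DifferentiableAt ℝ f ![p.1, p.2, t]) :
    fderiv ℝ (fun q : ℝ × ℝ => f ![q.1, q.2, t]) p (1, 0) = pd 0 f ![p.1, p.2, t] ∧
      fderiv ℝ (fun q : ℝ × ℝ => f ![q.1, q.2, t]) p (0, 1) = pd 1 f ![p.1, p.2, t] := by
  let L : ℝ × ℝ →L[ℝ] V3 := ContinuousLinearMap.pi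
    ![ContinuousLinearMap.fst ℝ ℝ ℝ, ContinuousLinearMap.snd ℝ ℝ ℝ, 0]
  have h1 : HasFDerivAt (fun q : ℝ × ℝ => (![q.1, q.2, t] : V3)) L p := by
    rw [hasFDerivAt_pi']
    intro i
    fin_cases i
    · exact hasFDerivAt_fst
    · exact hasFDerivAt_snd
    · exact hasFDerivAt_const t p
  have h2 : fderiv ℝ (fun q : ℝ × ℝ => f ![q.1, q.2, t]) p = _ :=
    (hf.hasFDerivAt.comp p h1).fderiv
  rw [h2]
  constructor
  · have : L (1, 0) = Pi.single 0 1 := by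
      ext i
      fin_cases i <;> simp [L]
    simp [this, pd]
  · have : L (0, 1) = Pi.single 1 1 := by
      ext i
      fin_cases i <;> simp [L]
    simp [this, pd]

/-- Derivative of a function on `ℝ³` along the axis. -/
theorem hasDerivAt_axis {f : V3 → ℂ} {x y t : ℝ} (hf : DifferentiableAt ℝ f ![x, y, t]) :
    HasDerivAt (fun s : ℝ => f ![x, y, s]) (pd 2 f ![x, y, t]) t := by
  have h1 : HasDerivAt (fun s : ℝ => (![x, y, s] : V3)) (Pi.single 2 1) t := by
    rw [hasDerivAt_pi]
    intro i
    fin_cases i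
    · simpa using hasDerivAt_const t x
    · simpa using hasDerivAt_const t y
    · simpa using hasDerivAt_id' t
  exact hf.hasFDerivAt.comp_hasDerivAt t h1

theorem continuousOn_pd {f : V3 → ℂ} {U : Set V3} (hU : IsOpen U) (hf : ContDiffOn ℝ 1 f U)
    (j : Fin 3) : ContinuousOn (pd j f) U :=
  (hf.continuousOn_fderiv_of_isOpen hU le_rfl).clm_apply continuousOn_const

theorem pd_eq_zero_of_axial {f : V3 → ℂ} {T : ℝ} (hf : ∀ x, T ≤ |x 2| → f x = 0)
    (j : Fin 3) {x : V3} (hx : T < |x 2|) : pd j f x = 0 := by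
  have hopen : IsOpen {y : V3 | T < |y 2|} := isOpen_lt (by fun_prop) (by fun_prop)
  have : f =ᶠ[nhds x] fun _ => 0 := by
    filter_upwards [hopen.mem_nhds hx] with y hy using hf y (le_of_lt hy)
  simp [pd, this.fderiv_eq]

/-- **Divergence theorem on the infinite cylinder**, for fields of compact axial support. -/
theorem integral_divergence_cyl {R : ℝ} (hR : 0 < R) {F : Fin 3 → V3 → ℂ} {U : Set V3}
    (hUo : IsOpen U) (hU : closure (Cyl R) ⊆ U) (hF : ∀ j, ContDiffOn ℝ 1 (F j) U)
    {T : ℝ} (hT : ∀ j x, T ≤ |x 2| → F j x = 0) :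
    ∫ x in Cyl R, ∑ j, pd j (F j) x = surfInt R (fun x => ∑ j, F j x * (nuR R x j : ℂ)) := by
  have hint : ∀ j, IntegrableOn (pd j (F j)) (Cyl R) := fun j =>
    integrableOn_cyl hR hU (continuousOn_pd hUo (hF j) j)
      fun x hx => pd_eq_zero_of_axial (hT j) j hx
  have hdiff : ∀ j x, x ∈ U → DifferentiableAt ℝ (F j) x := fun j x hx =>
    ((hF j).contDiffAt (hUo.mem_nhds hx)).differentiableAt one_ne_zero
  have hmem : ∀ {p : ℝ × ℝ} (t : ℝ), p.1 ^ 2 + p.2 ^ 2 ≤ R ^ 2 → ![p.1, p.2, t] ∈ U :=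
    fun t hp => hU (mem_closure_cyl hR (by simpa using hp))
  have hDm : MeasurableSet {p : ℝ × ℝ | p.1 ^ 2 + p.2 ^ 2 < R ^ 2} :=
    measurableSet_lt (by fun_prop) (by fun_prop)
  have hvert : ∫ x in Cyl R, pd 2 (F 2) x = 0 := by
    rw [setIntegral_cyl, integral_prod _ (integrableOn_planeAxis (hint 2))]
    refine setIntegral_eq_zero_of_forall_eq_zero fun p hp => ?_
    have hline : Continuous fun t : ℝ => (![p.1, p.2, t] : V3) := by
      refine continuous_pi fun i => ?_
      fin_cases i <;> simp <;> fun_prop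
    have hmaps : ∀ t, ![p.1, p.2, t] ∈ U := fun t => hmem t (le_of_lt hp)
    have hsupp : ∀ {u : ℝ → ℂ}, Continuous u → (∀ t, T < |t| → u t = 0) → Integrable u := by
      intro u hu h0
      refine hu.integrable_of_hasCompactSupport
        (HasCompactSupport.intro (isCompact_Icc (a := -T) (b := T)) fun t ht => h0 t ?_)
      by_contra! h
      exact ht (abs_le.1 h)
    refine integral_eq_zero_of_hasDerivAt_of_integrable
      (fun t => hasDerivAt_axis (hdiff 2 _ (hmaps t))) (hsupp ?_ ?_) (hsupp ?_ ?_)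
    · exact (continuousOn_pd hUo (hF 2) 2).comp_continuous hline hmaps
    · exact fun t ht => pd_eq_zero_of_axial (hT 2) 2 (by simpa using ht)
    · exact (hF 2).continuousOn.comp_continuous hline hmaps
    · exact fun t ht => hT 2 _ (by simpa using ht.le)
  have hhor : ∫ x in Cyl R, (pd 0 (F 0) x + pd 1 (F 1) x)
      = surfInt R (fun x => ∑ j, F j x * (nuR R x j : ℂ)) := by
    rw [setIntegral_cyl]
    refine (integral_prod_symm _ (integrableOn_planeAxis ((hint 0).add (hint 1)))).trans ?_
    refine integral_congr_ae (Filter.Eventually.of_forall fun t => ?_)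
    have hcont : ContDiff ℝ 1 fun p : ℝ × ℝ => (![p.1, p.2, t] : V3) := by
      refine contDiff_pi.2 fun i => ?_
      fin_cases i <;> simp <;> fun_prop
    have hdisc := integral_divergence_disc hR
      (f := fun p => F 0 ![p.1, p.2, t]) (g := fun p => F 1 ![p.1, p.2, t])
      (hUo.preimage hcont.continuous) (fun p hp => hmem t hp)
      ((hF 0).comp hcont.contDiffOn fun p hp => hp)
      ((hF 1).comp hcont.contDiffOn fun p hp => hp)
    refine (setIntegral_congr_fun hDm fun p hp => ?_).trans (hdisc.trans ?_)
    · have h0 := (fderiv_slice (hdiff 0 _ (hmem t (le_of_lt hp)))).1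
      have h1 := (fderiv_slice (hdiff 1 _ (hmem t (le_of_lt hp)))).2
      simp only [h0, h1, Pi.add_apply]
    · refine intervalIntegral.integral_congr fun θ _ => ?_
      have hR' : (R : ℂ) ≠ 0 := by exact_mod_cast hR.ne'
      simp [Fin.sum_univ_three, nuR]
      field_simp
  rw [← hhor, ← add_zero (∫ x in Cyl R, (pd 0 (F 0) x + pd 1 (F 1) x)), ← hvert]
  simp only [Fin.sum_univ_three]
  exact integral_add ((hint 0).add (hint 1)) (hint 2)

theorem pdR_mul {f g : V3 → ℝ} {x : V3} (hf : DifferentiableAt ℝ f x)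
    (hg : DifferentiableAt ℝ g x) (j : Fin 3) :
    pdR j (fun y => f y * g y) x = pdR j f x * g x + f x * pdR j g x := by
  simp only [pdR, fderiv_fun_mul hf hg, add_apply, smul_apply, smul_eq_mul]
  ring

theorem pdR_inv {f : V3 → ℝ} {x : V3} (hf : DifferentiableAt ℝ f x) (h0 : f x ≠ 0)
    (j : Fin 3) : pdR j (fun y => (f y)⁻¹) x = -pdR j f x / f x ^ 2 := by
  have h : fderiv ℝ (fun y => (f y)⁻¹) x = _ :=
    ((hasDerivAt_inv h0).comp_hasFDerivAt x hf.hasFDerivAt).fderiv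
  simp only [pdR, h, smul_apply, smul_eq_mul]
  ring

theorem pdR_sqrt {f : V3 → ℝ} {x : V3} (hf : DifferentiableAt ℝ f x) (h0 : f x ≠ 0)
    (j : Fin 3) : pdR j (fun y => Real.sqrt (f y)) x = pdR j f x / (2 * Real.sqrt (f x)) := by
  simp only [pdR, fderiv_sqrt hf h0, smul_apply, smul_eq_mul]
  ring

theorem pd_mul {f g : V3 → ℂ} {x : V3} (hf : DifferentiableAt ℝ f x)
    (hg : DifferentiableAt ℝ g x) (j : Fin 3) :
    pd j (fun y => f y * g y) x = pd j f x * g x + f x * pd j g x := by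
  simp only [pd, fderiv_fun_mul hf hg, add_apply, smul_apply, smul_eq_mul]
  ring

theorem pd_ofReal {f : V3 → ℝ} {x : V3} (hf : DifferentiableAt ℝ f x) (j : Fin 3) :
    pd j (fun y => (f y : ℂ)) x = (pdR j f x : ℂ) := by
  have h : fderiv ℝ (fun y => (f y : ℂ)) x = _ :=
    (Complex.ofRealCLM.hasFDerivAt.comp x hf.hasFDerivAt).fderiv
  simp [pd, h, pdR]

theorem pd_conj {f : V3 → ℂ} {x : V3} (hf : DifferentiableAt ℝ f x) (j : Fin 3) :
    pd j (fun y => (starRingEnd ℂ) (f y)) x = (starRingEnd ℂ) (pd j f x) := by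
  have h : fderiv ℝ (fun y => (starRingEnd ℂ) (f y)) x = _ :=
    (Complex.conjCLE.toContinuousLinearMap.hasFDerivAt.comp x hf.hasFDerivAt).fderiv
  simp [pd, h]

theorem differentiableAt_conj {f : V3 → ℂ} {x : V3} (hf : DifferentiableAt ℝ f x) :
    DifferentiableAt ℝ (fun y => (starRingEnd ℂ) (f y)) x :=
  Complex.conjCLE.toContinuousLinearMap.differentiableAt.comp x hf

theorem differentiableAt_ofReal_comp {f : V3 → ℝ} {x : V3} (hf : DifferentiableAt ℝ f x) :
    DifferentiableAt ℝ (fun y => (f y : ℂ)) x :=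
  Complex.ofRealCLM.differentiableAt.comp x hf

theorem pdV_real_smul {r : V3 → ℝ} {a : V3 → C3} {x : V3} (hr : DifferentiableAt ℝ r x)
    (ha : DifferentiableAt ℝ a x) (j : Fin 3) :
    pdV j (fun y => (r y : ℂ) • a y) x = (pdR j r x : ℂ) • a x + (r x : ℂ) • pdV j a x := by
  ext i
  simp only [pdV, Pi.smul_apply, Pi.add_apply, smul_eq_mul]
  rw [pd_mul (differentiableAt_ofReal_comp hr) (differentiableAt_pi.1 ha i), pd_ofReal hr]

theorem differentiableAt_hinner {a b : V3 → C3} {x : V3} (ha : DifferentiableAt ℝ a x)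
    (hb : DifferentiableAt ℝ b x) : DifferentiableAt ℝ (fun y => hinner (a y) (b y)) x :=
  DifferentiableAt.fun_sum fun i _ =>
    (differentiableAt_pi.1 ha i).mul (differentiableAt_conj (differentiableAt_pi.1 hb i))

theorem pd_hinner {a b : V3 → C3} {x : V3} (ha : DifferentiableAt ℝ a x)
    (hb : DifferentiableAt ℝ b x) (j : Fin 3) :
    pd j (fun y => hinner (a y) (b y)) x
      = hinner (pdV j a x) (b x) + hinner (a x) (pdV j b x) := by
  have hai := differentiableAt_pi.1 ha
  have hbi := fun i => differentiableAt_conj (differentiableAt_pi.1 hb i)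
  have hm : ∀ i, DifferentiableAt ℝ (fun y => a y i * (starRingEnd ℂ) (b y i)) x :=
    fun i => (hai i).mul (hbi i)
  have h : pd j (fun y => hinner (a y) (b y)) x
      = ∑ i, pd j (fun y => a y i * (starRingEnd ℂ) (b y i)) x := by
    simp only [pd, hinner]
    rw [fderiv_fun_sum fun i _ => hm i]
    simp
  rw [h]
  simp only [hinner, ← Finset.sum_add_distrib]
  refine Finset.sum_congr rfl fun i _ => ?_
  rw [pd_mul (hai i) (hbi i), pd_conj (differentiableAt_pi.1 hb i)]
  rfl

theorem hinner_real_combination (r s t q : ℝ) (u v w z : C3) :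
    hinner ((r : ℂ) • u + (s : ℂ) • v) ((t : ℂ) • w + (q : ℂ) • z)
      = r * t * hinner u w + r * q * hinner u z + s * t * hinner v w + s * q * hinner v z := by
  simp only [hinner, Fin.sum_univ_three, Pi.add_apply, Pi.smul_apply, smul_eq_mul, map_add,
    map_mul, Complex.conj_ofReal]
  ring

/-- The pointwise identity behind the rebalancing of weights: the two weighted gradient
products differ by lower order terms and a divergence. -/
theorem hinner_weight_rebalance {μ : V3 → ℝ} {a b : V3 → C3} {x : V3} {j : Fin 3}
    (hμ : DifferentiableAt ℝ μ x) (hμ' : DifferentiableAt ℝ (pdR j μ) x) (hpos : 0 < μ x)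
    (ha : DifferentiableAt ℝ a x) (hb : DifferentiableAt ℝ b x) :
    hinner (pdV j (fun y => (μ y : ℂ) • a y) x)
        (pdV j (fun y => (((μ y)⁻¹ : ℝ) : ℂ) • b y) x)
      = hinner (pdV j (fun y => (Real.sqrt (μ y) : ℂ) • a y) x)
          (pdV j (fun y => (((Real.sqrt (μ y))⁻¹ : ℝ) : ℂ) • b y) x)
        - (((μ x)⁻¹ : ℝ) : ℂ) * ((pdR j μ x : ℂ) * hinner (pdV j a x) (b x))
        - (((4 * (μ x) ^ 2)⁻¹ * (pdR j μ x) ^ 2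
            + (2 * μ x)⁻¹ * pdR j (pdR j μ) x : ℝ) : ℂ) * hinner (a x) (b x)
        + pd j (fun y => (((2 * μ y)⁻¹ * pdR j μ y : ℝ) : ℂ) * hinner (a y) (b y)) x := by
  have hi : DifferentiableAt ℝ (fun y => (μ y)⁻¹) x := hμ.inv hpos.ne'
  have hs : DifferentiableAt ℝ (fun y => Real.sqrt (μ y)) x := hμ.sqrt hpos.ne'
  have hs0 : Real.sqrt (μ x) ≠ 0 := (Real.sqrt_pos.2 hpos).ne'
  have hsi : DifferentiableAt ℝ (fun y => (Real.sqrt (μ y))⁻¹) x := hs.inv hs0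
  have h2 : DifferentiableAt ℝ (fun y => 2 * μ y) x := hμ.const_mul 2
  have h20 : 2 * μ x ≠ 0 := by positivity
  have h2i : DifferentiableAt ℝ (fun y => (2 * μ y)⁻¹) x := h2.inv h20
  have hw : DifferentiableAt ℝ (fun y => (2 * μ y)⁻¹ * pdR j μ y) x := h2i.mul hμ'
  have h2d : pdR j (fun y => 2 * μ y) x = 2 * pdR j μ x := by
    simp [pdR, fderiv_const_mul hμ]
  rw [pdV_real_smul hμ ha, pdV_real_smul hi hb, pdV_real_smul hs ha,
    pdV_real_smul hsi hb,
    pd_mul (differentiableAt_ofReal_comp hw) (differentiableAt_hinner ha hb),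
    pd_ofReal hw, pd_hinner ha hb, pdR_mul h2i hμ', pdR_inv h2 h20, h2d,
    pdR_inv hμ hpos.ne', pdR_inv hs hs0, pdR_sqrt hμ hpos.ne']
  simp only [hinner_real_combination]
  obtain ⟨s, hsp, hsμ⟩ : ∃ s : ℝ, 0 < s ∧ μ x = s ^ 2 :=
    ⟨Real.sqrt (μ x), Real.sqrt_pos.2 hpos, (Real.sq_sqrt hpos.le).symm⟩
  have hsC : (s : ℂ) ≠ 0 := by exact_mod_cast hsp.ne'
  rw [hsμ, Real.sqrt_sq hsp.le]
  push_cast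
  field_simp
  ring

theorem contDiffOn_hinner {n : WithTop ℕ∞} {a b : V3 → C3} {U : Set V3}
    (ha : ContDiffOn ℝ n a U) (hb : ContDiffOn ℝ n b U) :
    ContDiffOn ℝ n (fun y => hinner (a y) (b y)) U :=
  ContDiffOn.sum fun i _ => (contDiffOn_pi.1 ha i).mul
    (Complex.conjCLE.toContinuousLinearMap.contDiff.comp_contDiffOn (contDiffOn_pi.1 hb i))

theorem continuousOn_hinner {a b : V3 → C3} {U : Set V3}
    (ha : ContinuousOn a U) (hb : ContinuousOn b U) :
    ContinuousOn (fun y => hinner (a y) (b y)) U :=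
  continuousOn_finsetSum _ fun i _ => (continuousOn_pi.1 ha i).mul
    (Complex.continuous_conj.comp_continuousOn (continuousOn_pi.1 hb i))

theorem contDiffOn_real_smul {n : WithTop ℕ∞} {r : V3 → ℝ} {a : V3 → C3} {U : Set V3}
    (hr : ContDiffOn ℝ n r U) (ha : ContDiffOn ℝ n a U) :
    ContDiffOn ℝ n (fun y => (r y : ℂ) • a y) U :=
  (Complex.ofRealCLM.contDiff.comp_contDiffOn hr).smul ha

theorem continuousOn_pdV {a : V3 → C3} {U : Set V3} (hU : IsOpen U) (ha : ContDiffOn ℝ 1 a U)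
    (j : Fin 3) : ContinuousOn (pdV j a) U :=
  continuousOn_pi.2 fun i => continuousOn_pd hU (contDiffOn_pi.1 ha i) j

theorem pdV_eq_zero_of_axial {a : V3 → C3} {T : ℝ} (ha : ∀ x, T ≤ |x 2| → a x = 0)
    (j : Fin 3) {x : V3} (hx : T < |x 2|) : pdV j a x = 0 := by
  ext i
  exact pd_eq_zero_of_axial (fun y hy => by simp [ha y hy]) j hx

theorem hinner_zero_left (b : C3) : hinner 0 b = 0 := by
  simp [hinner]

/-- the identity of Lemma 2.5 (rebalancing of the weights μ and μ⁻¹). -/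
theorem statement9 (R : ℝ) (hR : 0 < R) (μ : V3 → ℝ) (a b : V3 → C3)
    (hμ : UpTo 2 (Cyl R) μ) (hpos : ∀ x ∈ closure (Cyl R), 0 < μ x)
    (ha : UpTo 1 (Cyl R) a) (hb : UpTo 1 (Cyl R) b) (has : AxialSupp a) :
    ∫ x in Cyl R, ∑ j, hinner (pdV j (fun y => (μ y : ℂ) • a y) x)
        (pdV j (fun y => (((μ y)⁻¹ : ℝ) : ℂ) • b y) x)
      = (∫ x in Cyl R, ∑ j, hinner (pdV j (fun y => (Real.sqrt (μ y) : ℂ) • a y) x)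
            (pdV j (fun y => (((Real.sqrt (μ y))⁻¹ : ℝ) : ℂ) • b y) x))
        - (∫ x in Cyl R, (((μ x)⁻¹ : ℝ) : ℂ)
            * ∑ j, (pdR j μ x : ℂ) * hinner (pdV j a x) (b x))
        - (∫ x in Cyl R,
            (((4 * (μ x) ^ 2)⁻¹ * (∑ i, (pdR i μ x) ^ 2) + (2 * μ x)⁻¹ * lapR μ x : ℝ) : ℂ)
              * hinner (a x) (b x))
        + surfInt R (fun x =>
            (((2 * μ x)⁻¹ * dnu R μ x : ℝ) : ℂ) * hinner (a x) (b x)) := by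
  obtain ⟨Um, hUm, hcm, hμ⟩ := hμ
  obtain ⟨Ua, hUa, hca, ha⟩ := ha
  obtain ⟨Ub, hUb, hcb, hb⟩ := hb
  obtain ⟨T, -, hT⟩ := has
  let U : Set V3 := (Um ∩ μ ⁻¹' Set.Ioi 0) ∩ (Ua ∩ Ub)
  have hU : IsOpen U :=
    (hμ.continuousOn.isOpen_inter_preimage hUm isOpen_Ioi).inter (hUa.inter hUb)
  have hcU : closure (Cyl R) ⊆ U := fun x hx => ⟨⟨hcm hx, hpos x hx⟩, hca hx, hcb hx⟩
  replace hμ : ContDiffOn ℝ 2 μ U := hμ.mono fun x hx => hx.1.1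
  replace ha : ContDiffOn ℝ 1 a U := ha.mono fun x hx => hx.2.1
  replace hb : ContDiffOn ℝ 1 b U := hb.mono fun x hx => hx.2.2
  have hμ0 : ∀ x ∈ U, 0 < μ x := fun x hx => hx.1.2
  have hμ1 : ContDiffOn ℝ 1 μ U := hμ.of_le one_le_two
  have hdμ : ∀ j, ContDiffOn ℝ 1 (pdR j μ) U := fun j =>
    (hμ.fderiv_of_isOpen hU (by norm_num)).clm_apply contDiffOn_const
  have hddμ : ∀ j, ContinuousOn (pdR j (pdR j μ)) U := fun j =>
    ((hdμ j).continuousOn_fderiv_of_isOpen hU le_rfl).clm_apply continuousOn_const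
  have hsqrt : ContDiffOn ℝ 1 (fun y => Real.sqrt (μ y)) U :=
    hμ1.sqrt fun x hx => (hμ0 x hx).ne'
  have hsqrt' : ContDiffOn ℝ 1 (fun y => (Real.sqrt (μ y))⁻¹) U :=
    hsqrt.inv fun x hx => (Real.sqrt_pos.2 (hμ0 x hx)).ne'
  let F : Fin 3 → V3 → ℂ := fun j y =>
    (((2 * μ y)⁻¹ * pdR j μ y : ℝ) : ℂ) * hinner (a y) (b y)
  have hF : ∀ j, ContDiffOn ℝ 1 (F j) U := fun j =>
    (Complex.ofRealCLM.contDiff.comp_contDiffOn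
      (((contDiffOn_const.mul hμ1).inv fun x hx => (mul_pos two_pos (hμ0 x hx)).ne').mul
        (hdμ j))).mul (contDiffOn_hinner ha hb)
  have hF0 : ∀ j x, T ≤ |x 2| → F j x = 0 := fun j x hx => by
    simp [F, hT x hx, hinner_zero_left]
  have hinv : ContinuousOn (fun x => (μ x)⁻¹) U :=
    hμ.continuousOn.inv₀ fun x hx => (hμ0 x hx).ne'
  have hi1 : IntegrableOn (fun x => ∑ j, hinner (pdV j (fun y => (Real.sqrt (μ y) : ℂ) • a y) x)
      (pdV j (fun y => (((Real.sqrt (μ y))⁻¹ : ℝ) : ℂ) • b y) x)) (Cyl R) := by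
    refine integrableOn_cyl hR hcU (continuousOn_finsetSum _ fun j _ => continuousOn_hinner
      (continuousOn_pdV hU (contDiffOn_real_smul hsqrt ha) j)
      (continuousOn_pdV hU (contDiffOn_real_smul hsqrt' hb) j)) (T := T) fun x hx => ?_
    refine Finset.sum_eq_zero fun j _ => ?_
    rw [pdV_eq_zero_of_axial (fun y hy => by simp [hT y hy]) j hx, hinner_zero_left]
  have hi2 : IntegrableOn (fun x => (((μ x)⁻¹ : ℝ) : ℂ)
      * ∑ j, (pdR j μ x : ℂ) * hinner (pdV j a x) (b x)) (Cyl R) := by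
    refine integrableOn_cyl hR hcU ((Complex.continuous_ofReal.comp_continuousOn hinv).mul
      (continuousOn_finsetSum _ fun j _ =>
        (Complex.continuous_ofReal.comp_continuousOn (hdμ j).continuousOn).mul
          (continuousOn_hinner (continuousOn_pdV hU ha j) hb.continuousOn))) (T := T)
      fun x hx => ?_
    simp [pdV_eq_zero_of_axial hT _ hx, hinner_zero_left]
  have hi3 : IntegrableOn (fun x =>
      (((4 * (μ x) ^ 2)⁻¹ * (∑ i, (pdR i μ x) ^ 2) + (2 * μ x)⁻¹ * lapR μ x : ℝ) : ℂ)
        * hinner (a x) (b x)) (Cyl R) := by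
    refine integrableOn_cyl hR hcU ((Complex.continuous_ofReal.comp_continuousOn ?_).mul
      (continuousOn_hinner ha.continuousOn hb.continuousOn)) (T := T) fun x hx => ?_
    · refine (ContinuousOn.mul ?_ (continuousOn_finsetSum _ fun j _ =>
        (hdμ j).continuousOn.pow 2)).add
        (ContinuousOn.mul ?_ (continuousOn_finsetSum _ fun j _ => hddμ j))
      · exact (continuousOn_const.mul (hμ.continuousOn.pow 2)).inv₀
          fun x hx => (mul_pos four_pos (pow_pos (hμ0 x hx) 2)).ne'
      · exact (continuousOn_const.mul hμ.continuousOn).inv₀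
          fun x hx => (mul_pos two_pos (hμ0 x hx)).ne'
    · simp [hT x hx.le, hinner_zero_left]
  have hi4 : IntegrableOn (fun x => ∑ j, pd j (F j) x) (Cyl R) :=
    integrableOn_cyl hR hcU (continuousOn_finsetSum _ fun j _ => continuousOn_pd hU (hF j) j)
      (T := T) fun x hx => Finset.sum_eq_zero fun j _ => pd_eq_zero_of_axial (hF0 j) j hx
  have hsurf : (fun x => (((2 * μ x)⁻¹ * dnu R μ x : ℝ) : ℂ) * hinner (a x) (b x))
      = fun x => ∑ j, F j x * (nuR R x j : ℂ) := by
    ext x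
    simp only [F, dnu, Fin.sum_univ_three]
    push_cast
    ring
  rw [hsurf, ← integral_divergence_cyl hR hU hcU hF hF0]
  refine Eq.trans ?_ ((integral_add ((hi1.sub hi2).sub hi3) hi4).trans (congrArg (· + _)
    ((integral_sub (hi1.sub hi2) hi3).trans (congrArg (· - _) (integral_sub hi1 hi2)))))
  refine setIntegral_congr_fun (isOpen_cyl R).measurableSet fun x hx => ?_
  have hxU : x ∈ U := hcU (subset_closure hx)
  have hat : ∀ {G : Type} [NormedAddCommGroup G] [NormedSpace ℝ G] {u : V3 → G},
      ContDiffOn ℝ 1 u U → DifferentiableAt ℝ u x := fun hu =>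
    (hu.contDiffAt (hU.mem_nhds hxU)).differentiableAt one_ne_zero
  have hpt := fun j => hinner_weight_rebalance (j := j) (hat hμ1) (hat (hdμ j)) (hμ0 x hxU)
    (hat ha) (hat hb)
  simp only [Pi.sub_apply, Fin.sum_univ_three, hpt, F, lapR]
  push_cast
  ring

end
end
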